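/- arXiv:2410.23852 — 2 statements merged into one kernel-verified Lean document; each statement's English description precedes it below -/
import Mathlib

section
/- For all real numbers 0 < m ≤ M there exist a constant C > 0 and an integer n₀ ≥ 2 such that: for every n ≥ n₀ and every invertible n×n real matrix A = (a_{ij}) with m ≤ a_{ij} ≤ M for all i ≠ j and 0 ≤ a_{ii} − Σ_{j≠i} a_{ji} ≤ M for all i, setting B := diag(1/a_{11}, …, 1/a_{nn}), one has ‖A⁻¹ − B‖_max ≤ C/n². (Uniform diagonal approximation of the inverse of a column-diagonally-dominant positive matrix; Lemma A.1.) -/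
open Finset

/-- A lower bound in `ℓ¹` for `1 + P`, where `P` is column-substochastic with zero diagonal and
off-diagonal entries at least `t`. -/
lemma sum_abs_le_of_substochastic {n : ℕ} (P : Matrix (Fin n) (Fin n) ℝ) {t : ℝ} (ht : 0 ≤ t)
    (hdiag : ∀ i, P i i = 0) (hoff : ∀ i k, i ≠ k → t ≤ P i k) (hcol : ∀ k, ∑ i, P i k ≤ 1)
    (x y : Fin n → ℝ) (h : ∀ i, x i + ∑ k, P i k * x k = y i) :
    t * (n - 4) * ∑ i, |x i| ≤ (2 + n * t) * ∑ i, |y i| := by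
  set s := ∑ i, x i with hs
  set Q : Fin n → Fin n → ℝ := fun i k => P i k - t + if i = k then t else 0 with hQ
  have hQ0 : ∀ i k, 0 ≤ Q i k := by
    intro i k
    by_cases hik : i = k
    · subst hik
      simp [hQ, hdiag]
    · simpa [hQ, hik] using hoff i k hik
  have hQcol : ∀ k, ∑ i, Q i k ≤ 1 - n * t + t := by
    intro k
    have := hcol k
    simp only [hQ, sum_add_distrib, sum_sub_distrib, sum_const, card_univ, Fintype.card_fin,
      nsmul_eq_mul, sum_ite_eq', mem_univ, if_true]
    linarith
  have hQx : ∀ i, ∑ k, Q i k * x k = ∑ k, P i k * x k - t * s + t * x i := by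
    intro i
    simp [hQ, add_mul, sub_mul, sum_add_distrib, sum_sub_distrib, mul_sum, hs]
  have hx : ∀ i, (1 - t) * |x i| ≤ |y i| + t * |s| + ∑ k, Q i k * |x k| := by
    intro i
    have e : (1 - t) * x i = y i - t * s - ∑ k, Q i k * x k := by
      rw [hQx, ← h i]
      ring
    calc (1 - t) * |x i| ≤ |1 - t| * |x i| := by gcongr; exact le_abs_self _
      _ = |y i - t * s - ∑ k, Q i k * x k| := by rw [← abs_mul, e]
      _ ≤ |y i| + |t * s| + |∑ k, Q i k * x k| :=
        (abs_sub _ _).trans (by gcongr; exact abs_sub _ _)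
      _ ≤ |y i| + t * |s| + ∑ k, Q i k * |x k| := by
        rw [abs_mul, abs_of_nonneg ht]
        gcongr
        refine (abs_sum_le_sum_abs _ _).trans (le_of_eq (sum_congr rfl fun k _ => ?_))
        rw [abs_mul, abs_of_nonneg (hQ0 i k)]
  have hsum := sum_le_sum fun i (_ : i ∈ univ) => hx i
  have hswap : ∑ i, ∑ k, Q i k * |x k| ≤ (1 - n * t + t) * ∑ k, |x k| := by
    rw [sum_comm, mul_sum]
    refine sum_le_sum fun k _ => ?_
    rw [← sum_mul]
    gcongr
    exact hQcol k
  simp only [sum_add_distrib, sum_const, card_univ, Fintype.card_fin, nsmul_eq_mul,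
    ← mul_sum] at hsum
  have htot : 2 * s = ∑ i, y i + ∑ k, (1 - ∑ i, P i k) * x k := by
    simp only [← h, sum_add_distrib, sub_mul, sum_sub_distrib, one_mul, sum_mul]
    rw [sum_comm (f := fun i k => P i k * x k)]
    ring
  have hP0 : ∀ k, 0 ≤ ∑ i, P i k := fun k => sum_nonneg fun i _ => by
    by_cases hik : i = k
    · rw [hik, hdiag]
    · exact ht.trans (hoff i k hik)
  have hs2 : 2 * |s| ≤ ∑ i, |y i| + ∑ i, |x i| := by
    have : |2 * s| = 2 * |s| := by rw [abs_mul, abs_two]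
    rw [← this, htot]
    refine (abs_add_le _ _).trans (add_le_add (abs_sum_le_sum_abs _ _)
      ((abs_sum_le_sum_abs _ _).trans (sum_le_sum fun k _ => ?_)))
    rw [abs_mul, abs_of_nonneg (sub_nonneg.2 (hcol k))]
    exact mul_le_of_le_one_left (abs_nonneg _) (by linarith [hP0 k])
  have := mul_le_mul_of_nonneg_left hs2 (mul_nonneg n.cast_nonneg ht)
  linarith

/-- Lemma A.1: uniform diagonal approximation of the inverse of a
column-diagonally-dominant positive matrix: `‖A⁻¹ - diag(1/aᵢᵢ)‖_max ≤ C/n²`. -/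
theorem inverse_diagonal_approximation
    (m M : ℝ) (hm : 0 < m) (hmM : m ≤ M) :
    ∃ C : ℝ, 0 < C ∧ ∃ n₀ : ℕ, 2 ≤ n₀ ∧
      ∀ n : ℕ, n₀ ≤ n →
        ∀ A : Matrix (Fin n) (Fin n) ℝ, IsUnit A.det →
          (∀ i j : Fin n, i ≠ j → m ≤ A i j ∧ A i j ≤ M) →
          (∀ i : Fin n, 0 ≤ A i i - ∑ j ∈ univ.erase i, A j i ∧
            A i i - ∑ j ∈ univ.erase i, A j i ≤ M) →
          ∀ i j : Fin n,
            |(A⁻¹ - Matrix.diagonal fun k => (A k k)⁻¹) i j| ≤ C / (n : ℝ) ^ 2 := by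
  have hM : 0 < M := hm.trans_le hmM
  refine ⟨24 * M ^ 2 / m ^ 3, by positivity, 8, by norm_num, ?_⟩
  intro n hn A hA hoff hdom i j
  have hn8 : (8 : ℝ) ≤ n := by exact_mod_cast hn
  have hcard : ∀ k : Fin n, ((univ.erase k).card : ℝ) = n - 1 := by
    intro k
    rw [card_erase_of_mem (mem_univ k), card_univ, Fintype.card_fin, Nat.cast_sub (by omega),
      Nat.cast_one]
  have hlow : ∀ k, m * n / 2 ≤ A k k := by
    intro k
    have := card_nsmul_le_sum (univ.erase k) (fun l => A l k) m
      fun l hl => (hoff l k (ne_of_mem_erase hl)).1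
    rw [nsmul_eq_mul, hcard] at this
    nlinarith [(hdom k).1]
  have hup : ∀ k, A k k ≤ n * M := by
    intro k
    have := sum_le_card_nsmul (univ.erase k) (fun l => A l k) M
      fun l hl => (hoff l k (ne_of_mem_erase hl)).2
    rw [nsmul_eq_mul, hcard] at this
    linarith [(hdom k).2]
  have hpos : ∀ k, 0 < A k k := fun k => lt_of_lt_of_le (by positivity) (hlow k)
  set v : Fin n → ℝ := fun k => A⁻¹ k j with hv
  have hAv : ∀ l, A l l * v l + ∑ k ∈ univ.erase l, A l k * v k = if l = j then 1 else 0 := by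
    intro l
    rw [add_sum_erase _ (fun k => A l k * v k) (mem_univ l), ← Matrix.one_apply,
      ← Matrix.mul_nonsing_inv A hA, Matrix.mul_apply]
  have hX : ∑ k, |A k k * v k| ≤ 6 * M / m := by
    have key := sum_abs_le_of_substochastic
      (Matrix.of fun l k => if l = k then 0 else A l k / A k k) (t := m / (n * M))
      (by positivity) (by simp)
      (by
        intro l k hlk
        simp only [Matrix.of_apply, hlk, if_false]
        exact div_le_div₀ (hm.le.trans (hoff l k hlk).1) (hoff l k hlk).1 (hpos k) (hup k))
      (by
        intro k
        rw [← add_sum_erase _ _ (mem_univ k)]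
        have : ∑ l ∈ univ.erase k, (Matrix.of fun l k => if l = k then 0 else A l k / A k k) l k
            = (∑ l ∈ univ.erase k, A l k) / A k k := by
          rw [sum_div]
          refine sum_congr rfl fun l hl => ?_
          simp [ne_of_mem_erase hl]
        rw [this, Matrix.of_apply, if_pos rfl, zero_add, div_le_one (hpos k)]
        linarith [(hdom k).1])
      (fun k => A k k * v k) (fun l => if l = j then 1 else 0)
      (by
        intro l
        rw [← hAv l, ← add_sum_erase _ _ (mem_univ l), Matrix.of_apply, if_pos rfl, zero_mul,
          zero_add]
        congr 1
        refine sum_congr rfl fun k hk => ?_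
        have := (hpos k).ne'
        rw [Matrix.of_apply, if_neg (ne_of_mem_erase hk).symm]
        field_simp)
    have hy : ∑ l : Fin n, |if l = j then (1 : ℝ) else 0| = 1 := by
      simp [apply_ite abs]
    rw [hy, mul_one] at key
    set X := ∑ k, |A k k * v k|
    have hX0 : 0 ≤ X := sum_nonneg fun _ _ => abs_nonneg _
    have hn0 : (0 : ℝ) < n := by linarith
    have e1 : m / (n * M) * (n - 4) * X = m * (n - 4) * X / (n * M) := by ring
    have e2 : 2 + n * (m / (n * M)) = n * (2 * M + m) / (n * M) := by field_simp
    rw [e1, e2, div_le_div_iff_of_pos_right (by positivity)] at key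
    rw [le_div_iff₀ hm]
    have h1 : n * (m * X) ≤ n * (6 * M) := by
      nlinarith [mul_nonneg (mul_nonneg hm.le hX0) (sub_nonneg.2 hn8),
        mul_nonneg hn0.le (sub_nonneg.2 hmM)]
    linarith [le_of_mul_le_mul_left h1 hn0]
  have hvsum : ∑ k, |v k| ≤ 6 * M / m / (m * n / 2) := by
    rw [le_div_iff₀ (by positivity)]
    refine le_trans ?_ hX
    rw [sum_mul]
    refine sum_le_sum fun k _ => ?_
    rw [abs_mul, abs_of_pos (hpos k), mul_comm]
    gcongr
    exact hlow k
  have hent : (A⁻¹ - Matrix.diagonal fun k => (A k k)⁻¹) i j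
      = -(∑ k ∈ univ.erase i, A i k * v k) / A i i := by
    have h1 := hAv i
    have h2 := (hpos i).ne'
    rw [Matrix.sub_apply, Matrix.diagonal_apply, eq_div_iff h2]
    change (v i - _) * _ = _
    split_ifs at h1 ⊢ <;> field_simp <;> linarith
  have hsum : |∑ k ∈ univ.erase i, A i k * v k| ≤ M * ∑ k, |v k| := by
    rw [mul_sum]
    refine (abs_sum_le_sum_abs _ _).trans ((sum_le_sum fun k hk => ?_).trans
      (sum_le_sum_of_subset_of_nonneg (erase_subset i univ) fun k _ _ => by positivity))
    have := hoff i k (ne_of_mem_erase hk).symm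
    rw [abs_mul, abs_of_nonneg (hm.le.trans this.1)]
    gcongr
    exact this.2
  rw [hent, abs_div, abs_neg, abs_of_pos (hpos i)]
  calc |∑ k ∈ univ.erase i, A i k * v k| / A i i
      ≤ M * (6 * M / m / (m * n / 2)) / (m * n / 2) := by
        gcongr
        · exact hsum.trans (by gcongr)
        · exact hlow i
    _ = 24 * M ^ 2 / m ^ 3 / (n : ℝ) ^ 2 := by
        field_simp
        norm_num
end

section
/- Let n ≥ 2 and let A = (a_{ij}) be an invertible n×n real matrix all of whose entries are strictly positive. Set B := diag(1/a_{11}, …, 1/a_{nn}) and F := A⁻¹ − B. Then for every row index i: Σ_{k=1}^{n} F_{ik}·a_{ki} = 0, and there exist column indices k and k′ with F_{ik} < 0 and F_{ik′} > 0. (Sign lemma from the proof of Lemma A.1.) -/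
open Finset

/-- sign lemma from the proof of Lemma A.1: for `F = A⁻¹ - diag(1/aᵢᵢ)`
with `A` invertible and entrywise positive, each row of `F` is `A`-orthogonal to the
corresponding column of `A`, and contains both a negative and a positive entry. -/
theorem inverse_minus_diagonal_sign_lemma
    (n : ℕ) (hn : 2 ≤ n)
    (A : Matrix (Fin n) (Fin n) ℝ) (hA : IsUnit A.det)
    (hpos : ∀ i j : Fin n, 0 < A i j) :
    ∀ i : Fin n,
      (∑ k, (A⁻¹ - Matrix.diagonal fun l => (A l l)⁻¹) i k * A k i = 0) ∧
      (∃ k : Fin n, (A⁻¹ - Matrix.diagonal fun l => (A l l)⁻¹) i k < 0) ∧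
      (∃ k' : Fin n, 0 < (A⁻¹ - Matrix.diagonal fun l => (A l l)⁻¹) i k') := by
  intro i
  set F := A⁻¹ - Matrix.diagonal fun l => (A l l)⁻¹ with hF
  have row_mul (j : Fin n) :
      ∑ k, F i k * A k j = (1 : Matrix (Fin n) (Fin n) ℝ) i j - (A i i)⁻¹ * A i j := by
    rw [← Matrix.mul_apply, hF, sub_mul, Matrix.nonsing_inv_mul A hA, Matrix.sub_apply,
      Matrix.diagonal_mul]
  have orth : ∑ k, F i k * A k i = 0 := by
    rw [row_mul, Matrix.one_apply_eq, inv_mul_cancel₀ (hpos i i).ne', sub_self]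
  have neg : ∃ k, F i k < 0 := by
    have : Nontrivial (Fin n) := Fin.nontrivial_iff_two_le.mpr hn
    obtain ⟨j, hj⟩ := exists_ne i
    by_contra! h
    have nonneg : 0 ≤ ∑ k, F i k * A k j :=
      Finset.sum_nonneg fun k _ => mul_nonneg (h k) (hpos k j).le
    rw [row_mul, Matrix.one_apply_ne hj.symm] at nonneg
    linarith [mul_pos (inv_pos.mpr (hpos i i)) (hpos i j)]
  refine ⟨orth, neg, ?_⟩
  obtain ⟨k, hk⟩ := neg
  by_contra! h
  exact (Finset.sum_neg' (fun l _ => mul_nonpos_of_nonpos_of_nonneg (h l) (hpos l i).le)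
    ⟨k, Finset.mem_univ k, mul_neg_of_neg_of_pos hk (hpos k i)⟩).ne orth
end
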